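/- Let B = {123, 312, 21543}. For n ∈ {3, 4} there is exactly one permutation σ ∈ S_n(B) with red_3(σ) = 213, and for every n ≥ 5 there is none. (Equivalently, F_{213}(x) = Σ_{n≥3} #{σ ∈ S_n(B) : red_3(σ) = 213} x^n = x³ + x⁴.) -/

import Mathlib

/-- `σ` contains the pattern `τ`. -/
def ContainsPat {n k : ℕ} (σ : Equiv.Perm (Fin n)) (τ : Equiv.Perm (Fin k)) : Prop :=
  ∃ f : Fin k → Fin n, StrictMono f ∧ ∀ a b : Fin k, σ (f a) < σ (f b) ↔ τ a < τ b

/-- `σ` avoids every pattern in the set `B`. -/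
def AvoidsAll {n : ℕ} (B : Set (Σ k, Equiv.Perm (Fin k))) (σ : Equiv.Perm (Fin n)) : Prop :=
  ∀ p ∈ B, ¬ ContainsPat σ p.2

/-- `red_m(σ) = π`: the entries of `σ` with values `< m`, read left to right, form `π`. -/
def IsRed {n m : ℕ} (σ : Equiv.Perm (Fin n)) (π : Equiv.Perm (Fin m)) : Prop :=
  ∃ g : Fin m → Fin n, StrictMono g ∧ ∀ j : Fin m, (σ (g j) : ℕ) = (π j : ℕ)

/-- The pattern 123 (0-based one-line notation). -/
noncomputable def p123 : Equiv.Perm (Fin 3) :=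
  Equiv.ofBijective ![0, 1, 2] (by decide)

/-- The pattern 312 (0-based one-line notation). -/
noncomputable def p312 : Equiv.Perm (Fin 3) :=
  Equiv.ofBijective ![2, 0, 1] (by decide)

/-- The pattern 21543 (0-based one-line notation). -/
noncomputable def p21543 : Equiv.Perm (Fin 5) :=
  Equiv.ofBijective ![1, 0, 4, 3, 2] (by decide)

/-- The pattern 213 (0-based one-line notation). -/
noncomputable def p213 : Equiv.Perm (Fin 3) :=
  Equiv.ofBijective ![1, 0, 2] (by decide)

noncomputable def c16 (n : ℕ) : ℕ :=
  Nat.card {σ : Equiv.Perm (Fin n) //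
    AvoidsAll ({⟨3, p123⟩, ⟨3, p312⟩, ⟨5, p21543⟩} : Set (Σ k, Equiv.Perm (Fin k))) σ ∧
    IsRed σ p213}

lemma contains_123_iff {n : ℕ} (σ : Equiv.Perm (Fin n)) :
    ContainsPat σ p123 ↔ ∃ i j k, i < j ∧ j < k ∧ σ i < σ j ∧ σ j < σ k := by
  constructor
  · rintro ⟨f, hf, h⟩
    exact ⟨f 0, f 1, f 2, hf (by decide), hf (by decide),
      (h 0 1).2 (by simp [p123]), (h 1 2).2 (by simp [p123])⟩
  · rintro ⟨i, j, k, h1, h2, h3, h4⟩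
    refine ⟨![i, j, k], ?_, ?_⟩
    · intro a b
      fin_cases a <;> fin_cases b <;> simp <;> omega
    · intro a b
      fin_cases a <;> fin_cases b <;> simp [p123] <;> omega

lemma contains_312_iff {n : ℕ} (σ : Equiv.Perm (Fin n)) :
    ContainsPat σ p312 ↔ ∃ i j k, i < j ∧ j < k ∧ σ j < σ k ∧ σ k < σ i := by
  constructor
  · rintro ⟨f, hf, h⟩
    exact ⟨f 0, f 1, f 2, hf (by decide), hf (by decide),
      (h 1 2).2 (by simp [p312]), (h 2 0).2 (by simp [p312])⟩
  · rintro ⟨i, j, k, h1, h2, h3, h4⟩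
    refine ⟨![i, j, k], ?_, ?_⟩
    · intro a b
      fin_cases a <;> fin_cases b <;> simp <;> omega
    · intro a b
      fin_cases a <;> fin_cases b <;> simp [p312] <;> omega

lemma contains_21543 {n : ℕ} (σ : Equiv.Perm (Fin n)) (a b c d e : Fin n)
    (h1 : a < b) (h2 : b < c) (h3 : c < d) (h4 : d < e)
    (k1 : σ b < σ a) (k2 : σ a < σ e) (k3 : σ e < σ d) (k4 : σ d < σ c) :
    ContainsPat σ p21543 := by
  refine ⟨![a, b, c, d, e], ?_, ?_⟩
  · intro x y
    fin_cases x <;> fin_cases y <;> simp <;> omega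
  · intro x y
    fin_cases x <;> fin_cases y <;> simp [p21543] <;> omega

lemma not_contains_small {n : ℕ} (hn : n < 5) (σ : Equiv.Perm (Fin n)) :
    ¬ ContainsPat σ p21543 := by
  rintro ⟨f, hf, -⟩
  have := Fintype.card_le_of_injective f hf.injective
  simp at this
  omega

lemma isRed_data {n : ℕ} {σ : Equiv.Perm (Fin n)} (h : IsRed σ p213) :
    ∃ a b c, a < b ∧ b < c ∧ (σ a : ℕ) = 1 ∧ (σ b : ℕ) = 0 ∧ (σ c : ℕ) = 2 := by
  obtain ⟨g, hg, h⟩ := h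
  exact ⟨g 0, g 1, g 2, hg (by decide), hg (by decide), by simp [h, p213],
    by simp [h, p213], by simp [h, p213]⟩

/-- Every large entry sits between the entries `1` and `3`. -/
lemma between {n : ℕ} {σ : Equiv.Perm (Fin n)} (h1 : ¬ ContainsPat σ p123)
    (h2 : ¬ ContainsPat σ p312) {b c p : Fin n} (hbc : b < c)
    (hb : (σ b : ℕ) = 0) (hc : (σ c : ℕ) = 2) (hp : 3 ≤ (σ p : ℕ)) : b < p ∧ p < c := by
  rw [contains_123_iff] at h1
  rw [contains_312_iff] at h2
  constructor
  · by_contra hlt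
    have hne : p ≠ b := by rintro rfl; omega
    exact h2 ⟨p, b, c, by omega, hbc, by omega, by omega⟩
  · by_contra hlt
    have hne : p ≠ c := by rintro rfl; omega
    exact h1 ⟨b, c, p, hbc, by omega, by omega, by omega⟩

lemma avoids_iff {n : ℕ} (σ : Equiv.Perm (Fin n)) :
    AvoidsAll ({⟨3, p123⟩, ⟨3, p312⟩, ⟨5, p21543⟩} : Set (Σ k, Equiv.Perm (Fin k))) σ ↔
      ¬ ContainsPat σ p123 ∧ ¬ ContainsPat σ p312 ∧ ¬ ContainsPat σ p21543 := by
  simp [AvoidsAll]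

noncomputable def q2143 : Equiv.Perm (Fin 4) :=
  Equiv.ofBijective ![1, 0, 3, 2] (by decide)

lemma c16_three : c16 3 = 1 := by
  rw [c16, Nat.card_eq_one_iff_unique]
  refine ⟨⟨?_⟩, ⟨⟨p213, ?_, ?_⟩⟩⟩
  · suffices H : ∀ σ : Equiv.Perm (Fin 3), IsRed σ p213 → σ = p213 by
      rintro ⟨σ, -, h⟩ ⟨τ, -, h'⟩
      exact Subtype.ext ((H σ h).trans (H τ h').symm)
    intro σ h
    obtain ⟨a, b, c, hab, hbc, ha, hb, hc⟩ := isRed_data h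
    obtain rfl : a = 0 := by omega
    obtain rfl : b = 1 := by omega
    obtain rfl : c = 2 := by omega
    ext i
    fin_cases i <;> simp [p213, ha, hb, hc]
  · rw [avoids_iff, contains_123_iff, contains_312_iff]
    refine ⟨?_, ?_, not_contains_small (by norm_num) _⟩ <;>
      simp only [p213, Equiv.ofBijective_apply] <;> decide
  · exact ⟨id, strictMono_id, fun _ => rfl⟩

lemma c16_four : c16 4 = 1 := by
  rw [c16, Nat.card_eq_one_iff_unique]
  refine ⟨⟨?_⟩, ⟨⟨q2143, ?_, ?_⟩⟩⟩
  · suffices H : ∀ σ : Equiv.Perm (Fin 4), ¬ ContainsPat σ p123 → ¬ ContainsPat σ p312 →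
        IsRed σ p213 → σ = q2143 by
      rintro ⟨σ, g, h⟩ ⟨τ, g', h'⟩
      rw [avoids_iff] at g g'
      exact Subtype.ext ((H σ g.1 g.2.1 h).trans (H τ g'.1 g'.2.1 h').symm)
    intro σ h1 h2 h
    obtain ⟨a, b, c, hab, hbc, ha, hb, hc⟩ := isRed_data h
    obtain ⟨p, hp⟩ := σ.surjective 3
    have hp' : (σ p : ℕ) = 3 := by rw [hp]; rfl
    obtain ⟨hbp, hpc⟩ := between h1 h2 hbc hb hc (p := p) (by omega)
    obtain rfl : a = 0 := by omega
    obtain rfl : b = 1 := by omega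
    obtain rfl : p = 2 := by omega
    obtain rfl : c = 3 := by omega
    ext i
    fin_cases i <;> simp [q2143, ha, hb, hc, hp]
  · rw [avoids_iff, contains_123_iff, contains_312_iff]
    refine ⟨?_, ?_, not_contains_small (by norm_num) _⟩ <;>
      simp only [q2143, Equiv.ofBijective_apply] <;> decide
  · refine ⟨![0, 1, 3], by decide, ?_⟩
    intro j
    fin_cases j <;> simp [q2143, p213]

lemma c16_large (n : ℕ) (hn : 5 ≤ n) : c16 n = 0 := by
  rw [c16, Nat.card_eq_zero]
  left
  refine ⟨?_⟩
  rintro ⟨σ, g, h⟩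
  rw [avoids_iff] at g
  obtain ⟨h1, h2, h3⟩ := g
  obtain ⟨a, b, c, hab, hbc, ha, hb, hc⟩ := isRed_data h
  obtain ⟨p, hp⟩ := σ.surjective ⟨3, by omega⟩
  obtain ⟨q, hq⟩ := σ.surjective ⟨4, by omega⟩
  have hp' : (σ p : ℕ) = 3 := by rw [hp]
  have hq' : (σ q : ℕ) = 4 := by rw [hq]
  obtain ⟨hbp, hpc⟩ := between h1 h2 hbc hb hc (p := p) (by omega)
  obtain ⟨hbq, hqc⟩ := between h1 h2 hbc hb hc (p := q) (by omega)
  have hne : p ≠ q := by rintro rfl; omega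
  rcases lt_or_gt_of_ne hne with hlt | hlt
  · exact h1 ((contains_123_iff σ).2 ⟨b, p, q, hbp, hlt, by omega, by omega⟩)
  · exact h3 (contains_21543 σ a b q p c hab hbq hlt hpc (by omega) (by omega)
      (by omega) (by omega))

theorem card_avoiders_123_312_21543_red213 :
    c16 3 = 1 ∧ c16 4 = 1 ∧ ∀ n : ℕ, 5 ≤ n → c16 n = 0 := by
  exact ⟨c16_three, c16_four, c16_large⟩
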